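/- arXiv:1903.08525 — 2 statements merged into one kernel-verified Lean document; each statement's English description precedes it below -/
import Mathlib

section
/- Let u : ℝ → ℝ be Lebesgue measurable and locally integrable with finite H^{1/2}(ℝ) seminorm. Then the function h_u : ℝ → ℝ defined by h_u(x) = ∫_0^x e^{u(t)} dt (with the sign convention h_u(x) = −∫_x^0 e^{u(t)} dt for x < 0) is a strictly increasing continuous bijection from ℝ onto ℝ. -/
open MeasureTheory
open scoped ENNReal

/-- The squared `H^{1/2}(ℝ)` seminorm
`‖u‖²_{H^{1/2}} = (1/2π²) ∫∫ (u(x)−u(y))²/(x−y)² dx dy`, as a value in `[0,∞]`. -/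
noncomputable def hHalfSeminormSq (u : ℝ → ℝ) : ℝ≥0∞ :=
  ENNReal.ofReal (1 / (2 * Real.pi ^ 2)) *
    ∫⁻ x, ∫⁻ y, ENNReal.ofReal ((u x - u y) ^ 2 / (x - y) ^ 2)

/-- Layer kernel. -/
noncomputable def layerG (u : ℝ → ℝ) (k : ℤ) (x y : ℝ) : ℝ≥0∞ :=
  Set.indicator {p : ℝ × ℝ | (k : ℝ) + 1 < u p.1 ∧ u p.2 ≤ k}
    (fun p => ENNReal.ofReal (1 / (p.1 - p.2) ^ 2)) (x, y)

noncomputable def layerT (u : ℝ → ℝ) (k : ℤ) : ℝ≥0∞ := ∫⁻ x, ∫⁻ y, layerG u k x y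

lemma layerG_meas (u : ℝ → ℝ) (hu : Measurable u) (k : ℤ) :
    Measurable (fun p : ℝ × ℝ => layerG u k p.1 p.2) := by
  unfold layerG
  apply Measurable.indicator
  · fun_prop
  · exact (measurableSet_lt measurable_const (hu.comp measurable_fst)).inter
      (measurableSet_le (hu.comp measurable_snd) measurable_const)

lemma layer_count (u : ℝ → ℝ) (x y : ℝ) :
    ∑' k : ℤ, layerG u k x y ≤ ENNReal.ofReal ((u x - u y) ^ 2 / (x - y) ^ 2) := by
  classical
  have hz : ∀ k : ℤ, k ∉ Finset.Icc ⌈u y⌉ (⌈u x⌉ - 2) → layerG u k x y = 0 := by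
    intro k hk
    unfold layerG
    rw [Set.indicator_of_notMem]
    rintro ⟨h1, h2⟩
    apply hk
    simp only at h1 h2
    rw [Finset.mem_Icc]
    refine ⟨Int.ceil_le.2 h2, ?_⟩
    have : k + 1 < ⌈u x⌉ := Int.lt_ceil.2 (by push_cast; exact h1)
    omega
  rw [tsum_eq_sum (fun k hk => hz k hk)]
  have hle : ∀ k ∈ Finset.Icc ⌈u y⌉ (⌈u x⌉ - 2),
      layerG u k x y ≤ ENNReal.ofReal (1 / (x - y) ^ 2) := by
    intro k _
    unfold layerG
    exact Set.indicator_le_self _ _ _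
  refine (Finset.sum_le_card_nsmul _ _ _ hle).trans ?_
  rw [nsmul_eq_mul, Int.card_Icc]
  by_cases hn : ⌈u x⌉ - 2 + 1 - ⌈u y⌉ ≤ 0
  · rw [Int.toNat_of_nonpos hn]; simp
  · push Not at hn
    set d := ⌈u x⌉ - 2 + 1 - ⌈u y⌉ with hd
    have h1 : (d : ℝ) ≤ u x - u y := by
      have a1 := (Int.ceil_lt_add_one (u x)).le
      have a2 := Int.le_ceil (u y)
      rw [hd]; push_cast; linarith
    have h2 : (1 : ℝ) ≤ d := by exact_mod_cast hn
    have h3 : ((d.toNat : ℕ) : ℝ≥0∞) = ENNReal.ofReal (d : ℝ) := by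
      rw [← ENNReal.ofReal_natCast]
      congr 1
      have := Int.toNat_of_nonneg hn.le
      exact_mod_cast this
    rw [h3, ← ENNReal.ofReal_mul (by linarith)]
    apply ENNReal.ofReal_le_ofReal
    rw [mul_one_div]
    gcongr
    nlinarith

lemma layer_sum (u : ℝ → ℝ) (hu : Measurable u) :
    ∑' k : ℤ, layerT u k ≤ ∫⁻ x, ∫⁻ y, ENNReal.ofReal ((u x - u y) ^ 2 / (x - y) ^ 2) := by
  unfold layerT
  rw [← lintegral_tsum (fun k => ((layerG_meas u hu k).lintegral_prod_right').aemeasurable)]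
  apply lintegral_mono
  intro x
  show ∑' k : ℤ, ∫⁻ y, layerG u k x y ≤ _
  rw [← lintegral_tsum (fun k => (show Measurable (fun y => layerG u k x y) from
    (layerG_meas u hu k).comp measurable_prodMk_left).aemeasurable)]
  exact lintegral_mono (fun y => layer_count u x y)

lemma layer_tendsto (u : ℝ → ℝ) (hu : Measurable u) (hfin : hHalfSeminormSq u < ⊤) :
    ∃ K : ℕ, ∀ k : ℤ, (K : ℤ) ≤ |k| → layerT u k ≤ 1 / 40 := by
  have h : ∑' k : ℤ, layerT u k ≠ ⊤ := by
    refine ne_top_of_le_ne_top ?_ (layer_sum u hu)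
    intro h
    unfold hHalfSeminormSq at hfin
    rw [h, ENNReal.mul_top] at hfin
    · exact absurd hfin (lt_irrefl _)
    · rw [Ne, ENNReal.ofReal_eq_zero, not_le]; positivity
  have ht := ENNReal.tendsto_cofinite_zero_of_tsum_ne_top h
  have he := ht.eventually (Iic_mem_nhds (show (0 : ℝ≥0∞) < 1 / 40 by simp))
  rw [Filter.eventually_cofinite] at he
  obtain ⟨K, hK⟩ := (he.image (fun k : ℤ => k.natAbs)).bddAbove
  refine ⟨K + 1, fun k hk => ?_⟩
  by_contra hc
  have : k.natAbs ≤ K := hK ⟨k, hc, rfl⟩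
  rw [Int.abs_eq_natAbs] at hk
  omega

/-- Key ratio estimate. -/
lemma layer_ratio (u : ℝ → ℝ) (hu : Measurable u) (I : Set ℝ) (hI : MeasurableSet I) (k : ℤ)
    (hfin : volume (I ∩ {x | (k : ℝ) < u x}) ≠ ⊤)
    (hgr : ∀ x ∈ I, ∀ m : ℝ, volume (I ∩ {x | (k : ℝ) < u x}) = ENNReal.ofReal m → 0 < m →
      ENNReal.ofReal (2 * m) ≤ volume (I ∩ Set.Icc (x - 2 * m) (x + 2 * m)))
    (hT : layerT u k ≤ 1 / 40) :
    10 * volume (I ∩ {x | (k : ℝ) + 1 < u x}) ≤ volume (I ∩ {x | (k : ℝ) < u x}) := by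
  set A := I ∩ {x | (k : ℝ) < u x} with hA
  set B := I ∩ {x | (k : ℝ) + 1 < u x} with hB
  have hBA : B ⊆ A := by
    rintro x ⟨h1, h2⟩
    refine ⟨h1, ?_⟩
    simp only [Set.mem_ofPred_eq] at h2 ⊢
    linarith
  have hBm : MeasurableSet B := hI.inter (measurableSet_lt measurable_const hu)
  have hAm : MeasurableSet A := hI.inter (measurableSet_lt measurable_const hu)
  by_cases h0 : volume A = 0
  · rw [measure_mono_null hBA h0]; simp
  set m := (volume A).toReal with hm
  have hmA : volume A = ENNReal.ofReal m := (ENNReal.ofReal_toReal hfin).symm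
  have hmpos : 0 < m := ENNReal.toReal_pos h0 hfin
  have key : ∀ x ∈ B, ENNReal.ofReal (1 / (4 * m)) ≤ ∫⁻ y, layerG u k x y := by
    intro x hx
    set S := (I ∩ Set.Icc (x - 2 * m) (x + 2 * m)) \ A with hS
    have hSm : MeasurableSet S := (hI.inter measurableSet_Icc).diff hAm
    have hSv : ENNReal.ofReal m ≤ volume S := by
      have h1 := le_measure_sdiff (μ := volume) (s₁ := I ∩ Set.Icc (x - 2 * m) (x + 2 * m)) (s₂ := A)
      refine le_trans ?_ h1
      rw [hmA]
      have h2 := hgr x hx.1 m hmA hmpos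
      refine le_trans ?_ (tsub_le_tsub_right h2 _)
      rw [← ENNReal.ofReal_sub _ hmpos.le]
      apply ENNReal.ofReal_le_ofReal; linarith
    calc ENNReal.ofReal (1 / (4 * m))
        = ENNReal.ofReal (1 / (2 * m) ^ 2) * ENNReal.ofReal m := by
          rw [← ENNReal.ofReal_mul (by positivity)]
          congr 1; field_simp; norm_num
      _ ≤ ENNReal.ofReal (1 / (2 * m) ^ 2) * volume S := by gcongr
      _ = ∫⁻ y in S, ENNReal.ofReal (1 / (2 * m) ^ 2) := by rw [setLIntegral_const]
      _ ≤ ∫⁻ y in S, layerG u k x y := by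
          apply setLIntegral_mono' hSm
          rintro y ⟨⟨hyI, hy1, hy2⟩, hyA⟩
          have hyk : u y ≤ k := by
            by_contra hc
            exact hyA ⟨hyI, not_le.1 hc⟩
          have hxk : (k : ℝ) + 1 < u x := hx.2
          have hne : x - y ≠ 0 := by
            intro h
            have : x = y := by linarith
            rw [this] at hxk; linarith
          unfold layerG
          rw [Set.indicator_of_mem (show (x, y) ∈ {p : ℝ × ℝ | (k : ℝ) + 1 < u p.1 ∧ u p.2 ≤ k} from ⟨hxk, hyk⟩)]
          apply ENNReal.ofReal_le_ofReal
          apply one_div_le_one_div_of_le (by positivity)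
          show (x - y) ^ 2 ≤ _
          nlinarith
      _ ≤ ∫⁻ y, layerG u k x y := setLIntegral_le_lintegral _ _
  have h1 : ENNReal.ofReal (1 / (4 * m)) * volume B ≤ 1 / 40 := by
    calc _ = ∫⁻ x in B, ENNReal.ofReal (1 / (4 * m)) := by rw [setLIntegral_const]
      _ ≤ ∫⁻ x in B, ∫⁻ y, layerG u k x y := setLIntegral_mono' hBm key
      _ ≤ layerT u k := setLIntegral_le_lintegral _ _
      _ ≤ _ := hT
  have hBf : volume B ≠ ⊤ := ne_top_of_le_ne_top hfin (measure_mono hBA)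
  have hbB : volume B = ENNReal.ofReal (volume B).toReal := (ENNReal.ofReal_toReal hBf).symm
  set b := (volume B).toReal with hb
  have hb0 : 0 ≤ b := ENNReal.toReal_nonneg
  have h40 : (1 / 40 : ℝ≥0∞) = ENNReal.ofReal (1 / 40) := by
    rw [ENNReal.ofReal_div_of_pos (by norm_num)]; simp
  have h10 : (10 : ℝ≥0∞) = ENNReal.ofReal 10 := by simp
  rw [hbB, ← ENNReal.ofReal_mul (by positivity), h40,
    ENNReal.ofReal_le_ofReal_iff (by norm_num)] at h1
  rw [hbB, hmA, h10, ← ENNReal.ofReal_mul (by norm_num)]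
  apply ENNReal.ofReal_le_ofReal
  have : 1 / (4 * m) * b = b / (4 * m) := by ring
  rw [this, div_le_iff₀ (by positivity)] at h1
  linarith

lemma lint_exp_finite (u : ℝ → ℝ) (hu : Measurable u) (hfin : hHalfSeminormSq u < ⊤)
    (R : ℝ) (hR : 0 < R) :
    ∫⁻ x in Set.Icc (-R) R, ENNReal.ofReal (Real.exp (u x)) < ⊤ := by
  obtain ⟨K0, hK0⟩ := layer_tendsto u hu hfin
  set I := Set.Icc (-R) R with hI
  have hIm : MeasurableSet I := measurableSet_Icc
  have hIf : volume I ≠ ⊤ := by rw [hI, Real.volume_Icc]; exact ENNReal.ofReal_ne_top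
  set a : ℕ → ℝ≥0∞ := fun n => volume (I ∩ {x | (n : ℝ) < u x}) with ha
  have hset : ∀ c : ℝ, MeasurableSet {x | c < u x} := fun c => measurableSet_lt measurable_const hu
  have hat : Filter.Tendsto a Filter.atTop (nhds 0) := by
    have := tendsto_measure_iInter_atTop (μ := volume) (s := fun n : ℕ => I ∩ {x | (n : ℝ) < u x})
      (fun n => (hIm.inter (hset n)).nullMeasurableSet)
      (by
        intro n p hnp x hx
        refine ⟨hx.1, ?_⟩
        have h2 := hx.2
        simp only [Set.mem_ofPred_eq] at h2 ⊢
        have : (n : ℝ) ≤ p := by exact_mod_cast hnp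
        linarith)
      ⟨0, ne_top_of_le_ne_top hIf (measure_mono Set.inter_subset_left)⟩
    have he : (⋂ n : ℕ, I ∩ {x | (n : ℝ) < u x}) = ∅ := by
      ext x
      simp only [Set.mem_iInter, Set.mem_inter_iff, Set.mem_ofPred_eq, Set.mem_empty_iff_false,
        iff_false, not_forall]
      obtain ⟨n, hn⟩ := exists_nat_gt (u x)
      exact ⟨n, fun h => by linarith [h.2]⟩
    rw [he, measure_empty] at this
    exact this
  have hev := hat.eventually (Iic_mem_nhds (show (0 : ℝ≥0∞) < ENNReal.ofReal R by simpa using hR))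
  obtain ⟨K1, hK1⟩ := Filter.eventually_atTop.1 hev
  set K := max K0 K1 with hK
  have hstep : ∀ n, K ≤ n → 10 * a (n + 1) ≤ a n := by
    intro n hn
    have hr := layer_ratio u hu I hIm (n : ℤ)
      (ne_top_of_le_ne_top hIf (measure_mono Set.inter_subset_left)) ?_ (hK0 n ?_)
    · simpa [ha] using hr
    · intro x hx m hm hmp
      have h1 : a n ≤ ENNReal.ofReal R := hK1 n (le_trans (le_max_right _ _) hn)
      simp only [ha] at h1
      simp only [Int.cast_natCast] at hm
      rw [hm, ENNReal.ofReal_le_ofReal_iff hR.le] at h1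
      rw [hI, Set.Icc_inter_Icc, Real.volume_Icc]
      apply ENNReal.ofReal_le_ofReal
      obtain ⟨hx1, hx2⟩ := hx
      rcases min_cases R (x + 2 * m) with h | h <;> rcases max_cases (-R) (x - 2 * m) with h' | h' <;>
      · rw [h.1, h'.1]; linarith
    · have : K0 ≤ n := le_trans (le_max_left _ _) hn
      rw [abs_of_nonneg (by positivity)]; exact_mod_cast this
  have hpow : ∀ n, a (K + n) ≤ ENNReal.ofReal (2 * R) * ENNReal.ofReal ((1 / 10) ^ n) := by
    intro n
    induction n with
    | zero =>
      simp only [pow_zero, ENNReal.ofReal_one, mul_one]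
      refine (measure_mono Set.inter_subset_left).trans ?_
      rw [hI, Real.volume_Icc]
      apply ENNReal.ofReal_le_ofReal; linarith
    | succ n ih =>
      have h := (hstep (K + n) (by omega)).trans ih
      have h' : a (K + n + 1) = ENNReal.ofReal (1 / 10) * (10 * a (K + n + 1)) := by
        rw [← mul_assoc, show (10 : ℝ≥0∞) = ENNReal.ofReal 10 by simp,
          ← ENNReal.ofReal_mul (by norm_num)]
        norm_num
      rw [← add_assoc, h']
      calc _ ≤ ENNReal.ofReal (1 / 10) *
            (ENNReal.ofReal (2 * R) * ENNReal.ofReal ((1 / 10) ^ n)) := by gcongr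
        _ = _ := by
          rw [pow_succ, ENNReal.ofReal_mul (show (0 : ℝ) ≤ (1 / 10) ^ n by positivity)]; ring
  have hpt : ∀ x, ENNReal.ofReal (Real.exp (u x)) ≤ ENNReal.ofReal (Real.exp K) +
      ∑' n : ℕ, Set.indicator {x | ((K + n : ℕ) : ℝ) < u x}
        (fun _ => ENNReal.ofReal (Real.exp ((K + n : ℕ) + 1))) x := by
    intro x
    by_cases hx : u x ≤ K
    · exact le_trans (ENNReal.ofReal_le_ofReal (Real.exp_le_exp.2 hx)) le_self_add
    · push Not at hx
      refine le_trans ?_ le_add_self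
      have hc : K < ⌈u x⌉₊ := Nat.lt_ceil.2 hx
      obtain ⟨n, hn⟩ : ∃ n, ⌈u x⌉₊ = K + n + 1 := ⟨⌈u x⌉₊ - K - 1, by omega⟩
      refine le_trans ?_ (ENNReal.le_tsum n)
      rw [Set.indicator_of_mem]
      · apply ENNReal.ofReal_le_ofReal
        apply Real.exp_le_exp.2
        have := Nat.le_ceil (u x)
        rw [hn] at this
        push_cast at this ⊢
        exact this
      · show ((K + n : ℕ) : ℝ) < u x
        apply Nat.lt_ceil.1; omega
  calc _ ≤ ∫⁻ x in I, (ENNReal.ofReal (Real.exp K) +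
      ∑' n : ℕ, Set.indicator {x | ((K + n : ℕ) : ℝ) < u x}
        (fun _ => ENNReal.ofReal (Real.exp ((K + n : ℕ) + 1))) x) := lintegral_mono hpt
    _ = ENNReal.ofReal (Real.exp K) * volume I +
        ∑' n : ℕ, ENNReal.ofReal (Real.exp ((K + n : ℕ) + 1)) * a (K + n) := by
      rw [lintegral_add_left measurable_const, setLIntegral_const, lintegral_tsum]
      · congr 2
        ext n
        rw [lintegral_indicator (hset _), setLIntegral_const, Measure.restrict_apply (hset _),
          Set.inter_comm]
      · intro n
        exact (measurable_const.indicator (hset _)).aemeasurable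
    _ ≤ ENNReal.ofReal (Real.exp K) * volume I +
        ∑' n : ℕ, ENNReal.ofReal (Real.exp (K + 1) * (2 * R)) *
          ENNReal.ofReal (3 / 10) ^ n := by
      refine add_le_add_right (ENNReal.tsum_le_tsum fun n => ?_) _
      refine (mul_le_mul_right (hpow n) _).trans ?_
      rw [← ENNReal.ofReal_pow (by norm_num), ← ENNReal.ofReal_mul (by positivity),
        ← ENNReal.ofReal_mul (by positivity), ← ENNReal.ofReal_mul (by positivity)]
      apply ENNReal.ofReal_le_ofReal
      have h3 : Real.exp n ≤ 3 ^ n := by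
        rw [← Real.exp_one_pow]
        gcongr
        linarith [Real.exp_one_lt_d9]
      have : Real.exp ((K + n : ℕ) + 1) = Real.exp (K + 1) * Real.exp n := by
        rw [← Real.exp_add]; push_cast; ring_nf
      rw [this, show (3 / 10 : ℝ) ^ n = 3 ^ n * (1 / 10) ^ n by rw [← mul_pow]; norm_num]
      calc _ = (Real.exp (K + 1) * (2 * R)) * (Real.exp n * (1 / 10) ^ n) := by ring
        _ ≤ _ := by gcongr
    _ < ⊤ := by
      rw [ENNReal.tsum_mul_left, ENNReal.tsum_geometric]
      refine ENNReal.add_lt_top.2 ⟨ENNReal.mul_lt_top ENNReal.ofReal_lt_top hIf.lt_top,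
        ENNReal.mul_lt_top ENNReal.ofReal_lt_top ?_⟩
      rw [ENNReal.inv_lt_top, tsub_pos_iff_lt]
      rw [← ENNReal.ofReal_one, ENNReal.ofReal_lt_ofReal_iff (by norm_num)]
      norm_num

lemma lint_exp_infinite (u : ℝ → ℝ) (hu : Measurable u) (hfin : hHalfSeminormSq u < ⊤)
    (I : Set ℝ) (hIm : MeasurableSet I) (hI0 : volume I ≠ 0)
    (hI : ∀ x ∈ I, ∀ m : ℝ, 0 < m → ENNReal.ofReal (2 * m) ≤
      volume (I ∩ Set.Icc (x - 2 * m) (x + 2 * m))) :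
    ∫⁻ x in I, ENNReal.ofReal (Real.exp (u x)) = ⊤ := by
  by_contra hC
  obtain ⟨K0, hK0⟩ := layer_tendsto u hu hfin
  set C := ∫⁻ x in I, ENNReal.ofReal (Real.exp (u x)) with hCdef
  have hset : ∀ c : ℝ, MeasurableSet {x | c < u x} := fun c => measurableSet_lt measurable_const hu
  set a : ℕ → ℝ≥0∞ := fun n => volume (I ∩ {x | -(n : ℝ) < u x}) with ha
  have hmarkov : ∀ n : ℕ, ENNReal.ofReal (Real.exp (-(n : ℝ))) * a n ≤ C := by
    intro n
    calc _ = ∫⁻ x in I ∩ {x | -(n : ℝ) < u x}, ENNReal.ofReal (Real.exp (-(n : ℝ))) := by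
          rw [setLIntegral_const]
      _ ≤ ∫⁻ x in I ∩ {x | -(n : ℝ) < u x}, ENNReal.ofReal (Real.exp (u x)) := by
          apply setLIntegral_mono' (hIm.inter (hset _))
          intro x hx
          exact ENNReal.ofReal_le_ofReal (Real.exp_le_exp.2 (le_of_lt hx.2))
      _ ≤ C := lintegral_mono_set Set.inter_subset_left
  have hafin : ∀ n, a n ≠ ⊤ := by
    intro n h
    have := hmarkov n
    rw [h, ENNReal.mul_top] at this
    · exact hC (top_le_iff.1 this)
    · rw [Ne, ENNReal.ofReal_eq_zero, not_le]; positivity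
  have hmono : Monotone a := by
    intro n p hnp
    apply measure_mono
    intro x hx
    refine ⟨hx.1, ?_⟩
    have h2 := hx.2
    simp only [Set.mem_ofPred_eq] at h2 ⊢
    have : (n : ℝ) ≤ p := by exact_mod_cast hnp
    linarith
  obtain ⟨K1, hK1⟩ : ∃ n, a n ≠ 0 := by
    by_contra h
    push Not at h
    apply hI0
    have : I ⊆ ⋃ n : ℕ, I ∩ {x | -(n : ℝ) < u x} := by
      intro x hx
      obtain ⟨n, hn⟩ := exists_nat_gt (-u x)
      exact Set.mem_iUnion.2 ⟨n, hx, by show -(n : ℝ) < u x; linarith⟩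
    exact measure_mono_null this (measure_iUnion_null h)
  set K := max K0 K1 with hK
  have hK' : a K ≠ 0 := fun h => hK1 (le_zero_iff.1 (h ▸ hmono (le_max_right _ _)))
  have hstep : ∀ n, K ≤ n → 10 * a n ≤ a (n + 1) := by
    intro n hn
    have hcast : ((-((n : ℤ) + 1) : ℤ) : ℝ) = -((n + 1 : ℕ) : ℝ) := by push_cast; ring
    have hr := layer_ratio u hu I hIm (-((n : ℤ) + 1)) (by rw [hcast]; exact hafin (n + 1))
      (fun x hx m _ hm => hI x hx m hm) (hK0 _ ?_)
    · rw [hcast, show -((n + 1 : ℕ) : ℝ) + 1 = -(n : ℝ) by push_cast; ring] at hr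
      exact hr
    · have : K0 ≤ n := le_trans (le_max_left _ _) hn
      rw [abs_neg, abs_of_nonneg (by positivity)]; omega
  have hpow : ∀ n, 10 ^ n * a K ≤ a (K + n) := by
    intro n
    induction n with
    | zero => simp
    | succ n ih =>
      calc _ = 10 * (10 ^ n * a K) := by ring
        _ ≤ 10 * a (K + n) := by gcongr
        _ ≤ _ := hstep (K + n) (by omega)
  set α := (a K).toReal with hα
  have hαpos : 0 < α := ENNReal.toReal_pos hK' (hafin K)
  have hreal : ∀ n : ℕ, Real.exp (-(K : ℝ)) * α * 3 ^ n ≤ C.toReal := by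
    intro n
    have h1 : ENNReal.ofReal (Real.exp (-((K + n : ℕ) : ℝ))) * (10 ^ n * a K) ≤ C :=
      le_trans (by gcongr; exact hpow n) (hmarkov (K + n))
    have h2 := ENNReal.toReal_mono hC h1
    rw [ENNReal.toReal_mul, ENNReal.toReal_mul, ENNReal.toReal_pow,
      ENNReal.toReal_ofReal (Real.exp_pos _).le] at h2
    refine le_trans ?_ h2
    have : Real.exp (-((K + n : ℕ) : ℝ)) = Real.exp (-(K : ℝ)) * Real.exp (-1) ^ n := by
      rw [← Real.exp_nat_mul, ← Real.exp_add]; push_cast; ring_nf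
    rw [this]
    have h10 : (10 : ℝ≥0∞).toReal = 10 := by simp
    rw [h10]
    have h3 : (3 : ℝ) ^ n ≤ Real.exp (-1) ^ n * 10 ^ n := by
      rw [← mul_pow]
      gcongr
      have := Real.exp_neg_one_gt_d9
      linarith
    calc _ ≤ Real.exp (-(K : ℝ)) * α * (Real.exp (-1) ^ n * 10 ^ n) := by gcongr
      _ = _ := by ring
  have hpos : 0 < Real.exp (-(K : ℝ)) * α := by positivity
  obtain ⟨n, hn⟩ := pow_unbounded_of_one_lt (C.toReal / (Real.exp (-(K : ℝ)) * α))
    (show (1 : ℝ) < 3 by norm_num)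
  rw [div_lt_iff₀ hpos] at hn
  have := hreal n
  linarith

/-- If `u : ℝ → ℝ` is measurable, locally integrable, with finite `H^{1/2}(ℝ)` seminorm,
then `h_u(x) = ∫_0^x e^{u(t)} dt` is a strictly increasing continuous bijection of `ℝ`. -/
theorem primitive_of_exp_hHalf_is_increasing_homeo
    (u : ℝ → ℝ) (hmeas : Measurable u) (hloc : LocallyIntegrable u volume)
    (hfin : hHalfSeminormSq u < ⊤) :
    StrictMono (fun x => ∫ t in (0:ℝ)..x, Real.exp (u t)) ∧
    Continuous (fun x => ∫ t in (0:ℝ)..x, Real.exp (u t)) ∧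
    Function.Bijective (fun x => ∫ t in (0:ℝ)..x, Real.exp (u t)) := by
  have hem : Measurable (fun t => Real.exp (u t)) := Real.measurable_exp.comp hmeas
  have hon : ∀ R : ℝ, 0 < R → IntegrableOn (fun t => Real.exp (u t)) (Set.Icc (-R) R) := by
    intro R hR
    refine ⟨hem.aestronglyMeasurable, ?_⟩
    rw [hasFiniteIntegral_iff_ofReal (Filter.Eventually.of_forall fun x => (Real.exp_pos _).le)]
    exact lint_exp_finite u hmeas hfin R hR
  have hint : ∀ a b : ℝ, IntervalIntegrable (fun t => Real.exp (u t)) volume a b := by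
    intro a b
    rw [intervalIntegrable_iff]
    apply (hon (|a| + |b| + 1) (by positivity)).mono_set
    intro x hx
    have hx := Set.uIoc_subset_uIcc hx
    rw [Set.mem_uIcc] at hx
    have := abs_nonneg a
    have := abs_nonneg b
    have := le_abs_self a
    have := le_abs_self b
    have := neg_abs_le a
    have := neg_abs_le b
    constructor <;> rcases hx with h | h <;> linarith [h.1, h.2]
  have hsm : StrictMono (fun x => ∫ t in (0:ℝ)..x, Real.exp (u t)) := by
    intro x y hxy
    have h1 := intervalIntegral.integral_add_adjacent_intervals (hint 0 x) (hint x y)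
    have h2 := intervalIntegral.intervalIntegral_pos_of_pos (hint x y)
      (fun t => Real.exp_pos (u t)) hxy
    show (∫ t in (0:ℝ)..x, Real.exp (u t)) < ∫ t in (0:ℝ)..y, Real.exp (u t)
    linarith
  have hc : Continuous (fun x => ∫ t in (0:ℝ)..x, Real.exp (u t)) :=
    intervalIntegral.continuous_primitive hint 0
  have hnorm : ∀ a b : ℝ, ∫ t in a..b, ‖Real.exp (u t)‖ = ∫ t in a..b, Real.exp (u t) := by
    intro a b
    simp only [Real.norm_eq_abs, Real.abs_exp]
  have htop : Filter.Tendsto (fun x => ∫ t in (0:ℝ)..x, Real.exp (u t))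
      Filter.atTop Filter.atTop := by
    apply Filter.tendsto_atTop_atTop_of_monotone' hsm.monotone
    rintro ⟨B, hB⟩
    have hI : IntegrableOn (fun t => Real.exp (u t)) (Set.Ioi 0) := by
      apply integrableOn_Ioi_of_intervalIntegral_norm_bounded (l := Filter.atTop)
        (b := fun x : ℝ => x) B 0 (fun i => (hint 0 i).1) Filter.tendsto_id
      refine Filter.Eventually.of_forall fun i => ?_
      rw [hnorm]
      exact hB ⟨i, rfl⟩
    have h2 := hI.2
    rw [hasFiniteIntegral_iff_ofReal (Filter.Eventually.of_forall fun x => (Real.exp_pos _).le),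
      lint_exp_infinite u hmeas hfin (Set.Ioi 0) measurableSet_Ioi (by simp)] at h2
    · exact lt_irrefl _ h2
    · intro x hx m hm
      have : Set.Icc x (x + 2 * m) ⊆ Set.Ioi 0 ∩ Set.Icc (x - 2 * m) (x + 2 * m) := by
        intro y hy
        refine ⟨lt_of_lt_of_le hx hy.1, ?_, hy.2⟩
        linarith [hy.1]
      refine le_trans ?_ (measure_mono this)
      rw [Real.volume_Icc]; apply ENNReal.ofReal_le_ofReal; linarith
  have hbot : Filter.Tendsto (fun x => ∫ t in (0:ℝ)..x, Real.exp (u t))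
      Filter.atBot Filter.atBot := by
    apply Filter.tendsto_atBot_atBot_of_monotone' hsm.monotone
    rintro ⟨B, hB⟩
    have hI : IntegrableOn (fun t => Real.exp (u t)) (Set.Iic 0) := by
      apply integrableOn_Iic_of_intervalIntegral_norm_bounded (l := Filter.atBot)
        (a := fun x : ℝ => x) (-B) 0 (fun i => (hint i 0).1) Filter.tendsto_id
      refine Filter.Eventually.of_forall fun i => ?_
      rw [hnorm, intervalIntegral.integral_symm]
      exact neg_le_neg (hB ⟨i, rfl⟩)
    have h2 := hI.2
    rw [hasFiniteIntegral_iff_ofReal (Filter.Eventually.of_forall fun x => (Real.exp_pos _).le),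
      lint_exp_infinite u hmeas hfin (Set.Iic 0) measurableSet_Iic (by simp)] at h2
    · exact lt_irrefl _ h2
    · intro x hx m hm
      have : Set.Icc (x - 2 * m) x ⊆ Set.Iic 0 ∩ Set.Icc (x - 2 * m) (x + 2 * m) := by
        intro y hy
        refine ⟨le_trans hy.2 hx, hy.1, ?_⟩
        linarith [hy.2]
      refine le_trans ?_ (measure_mono this)
      rw [Real.volume_Icc]; apply ENNReal.ofReal_le_ofReal; linarith
  exact ⟨hsm, hc, hsm.injective, hc.surjective htop hbot⟩
end

section
/- Let u : ℂ → ℝ be continuously differentiable with ∫_ℂ ‖∇u(z)‖² dA(z) < ∞. Then u can be approximated in the homogeneous Dirichlet seminorm by smooth compactly supported functions: for every ε > 0 there exists an infinitely differentiable function v : ℂ → ℝ with compact support such that ∫_ℂ ‖∇u(z) − ∇v(z)‖² dA(z) < ε. -/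
open MeasureTheory
open scoped ENNReal

namespace DirichletDensity
open Filter Topology Set Metric

/-- The radial majorant of the squared gradient of the log-log function is integrable. -/
lemma integrable_majorant :
    Integrable (fun z : ℂ => 4 / ((1 + ‖z‖ ^ 2) * (1 + Real.log (1 + ‖z‖ ^ 2)) ^ 2)) := by
  rw [integrable_fun_norm_addHaar (volume : Measure ℂ)
    (f := fun r : ℝ => 4 / ((1 + r ^ 2) * (1 + Real.log (1 + r ^ 2)) ^ 2))]
  have hL : ∀ r : ℝ, 0 ≤ Real.log (1 + r ^ 2) := fun r => Real.log_nonneg (by nlinarith [sq_nonneg r])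
  have key : IntegrableOn (fun r : ℝ => r * (4 / ((1 + r ^ 2) * (1 + Real.log (1 + r ^ 2)) ^ 2)))
      (Ioi 0) := by
    refine integrableOn_Ioi_deriv_of_nonneg' (l := 0)
      (g := fun r : ℝ => -2 * (1 + Real.log (1 + r ^ 2))⁻¹) ?_ ?_ ?_
    · intro r _
      have h1 : (1 + r ^ 2) ≠ 0 := by positivity
      have h2 : 1 + Real.log (1 + r ^ 2) ≠ 0 := by linarith [hL r]
      have := (((((hasDerivAt_id r).pow 2).const_add 1).log h1).const_add 1).inv h2
      convert! this.const_mul (-2) using 1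
      simp
      field_simp
      ring
    · intro r hr
      have := hL r
      have hr' : 0 < r := hr
      positivity
    · have h1 : Tendsto (fun r : ℝ => 1 + r ^ 2) atTop atTop :=
        tendsto_atTop_add_const_left _ _ (tendsto_pow_atTop two_ne_zero)
      have h2 : Tendsto (fun r : ℝ => 1 + Real.log (1 + r ^ 2)) atTop atTop :=
        tendsto_atTop_add_const_left _ _ (Real.tendsto_log_atTop.comp h1)
      simpa using (tendsto_inv_atTop_zero.comp h2).const_mul (-2)
  simpa using key

/-- The log-log function. -/
noncomputable def gg (z : ℂ) : ℝ := Real.log (1 + Real.log (1 + ‖z‖ ^ 2))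

lemma L_nonneg (z : ℂ) : 0 ≤ Real.log (1 + ‖z‖ ^ 2) :=
  Real.log_nonneg (by nlinarith [sq_nonneg ‖z‖])

lemma contDiff_gg : ContDiff ℝ 1 gg := by
  unfold gg
  refine ContDiff.log (contDiff_const.add (ContDiff.log (contDiff_const.add
    (contDiff_norm_sq ℝ)) ?_)) ?_
  · intro z; positivity
  · intro z; linarith [L_nonneg z]

lemma norm_fderiv_gg (z : ℂ) :
    ‖fderiv ℝ gg z‖ ^ 2 ≤ 4 / ((1 + ‖z‖ ^ 2) * (1 + Real.log (1 + ‖z‖ ^ 2)) ^ 2) := by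
  have h1 : (1 + ‖z‖ ^ 2) ≠ 0 := by positivity
  have hL := L_nonneg z
  have h2 : 1 + Real.log (1 + ‖z‖ ^ 2) ≠ 0 := by linarith
  have hd := (((((hasStrictFDerivAt_norm_sq z).hasFDerivAt).const_add 1).log h1).const_add 1).log h2
  have hd' : fderiv ℝ gg z = _ := hd.fderiv
  rw [hd', ← Nat.cast_smul_eq_nsmul ℝ, norm_smul, norm_smul, norm_smul, innerSL_apply_norm]
  clear hd hd'
  simp only [norm_inv, Real.norm_eq_abs, abs_of_nonneg (show 0 ≤ 1 + ‖z‖ ^ 2 by positivity),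
    abs_of_nonneg (show 0 ≤ 1 + Real.log (1 + ‖z‖ ^ 2) by positivity)]
  have h3 : 0 < 1 + Real.log (1 + ‖z‖ ^ 2) := by positivity
  have h4 : 0 < 1 + ‖z‖ ^ 2 := by positivity
  rw [le_div_iff₀ (by positivity)]
  generalize 1 + Real.log (1 + ‖z‖ ^ 2) = A at *
  norm_num
  field_simp
  nlinarith

lemma norm_le_of_gg_le {z : ℂ} {a : ℝ} (h : gg z ≤ a) :
    ‖z‖ ≤ Real.exp (Real.exp a) := by
  unfold gg at h
  have hL := L_nonneg z
  rw [Real.log_le_iff_le_exp (by positivity)] at h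
  have h' : Real.log (1 + ‖z‖ ^ 2) ≤ Real.exp a := by linarith
  rw [Real.log_le_iff_le_exp (by positivity)] at h'
  nlinarith [norm_nonneg z]

/-- Mollification of compactly supported `C¹` functions. -/
lemma mollify (w : ℂ → ℝ) (hw : ContDiff ℝ 1 w) (hc : HasCompactSupport w) :
    ∃ R : ℝ, ∀ δ > (0:ℝ), ∃ v : ℂ → ℝ, ContDiff ℝ (⊤ : ℕ∞) v ∧ HasCompactSupport v ∧
      (∀ z, ‖fderiv ℝ w z - fderiv ℝ v z‖ ≤ δ) ∧
      (∀ z, z ∉ closedBall (0:ℂ) R → fderiv ℝ w z - fderiv ℝ v z = 0) := by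
  have hDc : HasCompactSupport (fderiv ℝ w) := hc.fderiv ℝ
  have hDcont : Continuous (fderiv ℝ w) := hw.continuous_fderiv one_ne_zero
  obtain ⟨R, hR⟩ := hDc.isCompact.isBounded.subset_closedBall (0:ℂ)
  refine ⟨R + 1, fun δ hδ => ?_⟩
  have hzero : ∀ x : ℂ, R < ‖x‖ → fderiv ℝ w x = 0 := by
    intro x hx
    by_contra hne
    have := hR (subset_tsupport _ (Function.mem_support.2 hne))
    rw [mem_closedBall_zero_iff] at this
    linarith
  have huc : UniformContinuous (fderiv ℝ w) := hDc.uniformContinuous_of_continuous hDcont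
  obtain ⟨η, hη, hηd⟩ := Metric.uniformContinuous_iff.1 huc δ hδ
  have hm : 0 < min η 1 := lt_min hη one_pos
  let φ : ContDiffBump (0:ℂ) := ⟨min η 1 / 2, min η 1, by positivity, by linarith⟩
  have hr : φ.rOut = min η 1 := rfl
  let v : ℂ → ℝ := convolution (φ.normed volume) w (ContinuousLinearMap.lsmul ℝ ℝ) volume
  have hli : LocallyIntegrable (φ.normed (volume : Measure ℂ)) :=
    φ.continuous_normed.locallyIntegrable
  have hder : ∀ z, fderiv ℝ v z = convolution (φ.normed volume) (fderiv ℝ w)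
      (ContinuousLinearMap.lsmul ℝ ℝ) volume z := by
    intro z
    rw [(hc.hasFDerivAt_convolution_right (ContinuousLinearMap.lsmul ℝ ℝ) hli hw z).fderiv]
    rfl
  refine ⟨v, ?_, ?_, ?_, ?_⟩
  · exact φ.hasCompactSupport_normed.contDiff_convolution_left _ φ.contDiff_normed
      hw.continuous.locallyIntegrable
  · exact HasCompactSupport.convolution _ φ.hasCompactSupport_normed hc
  · intro z
    rw [hder, ← dist_eq_norm, dist_comm]
    refine φ.dist_normed_convolution_le hDcont.aestronglyMeasurable fun x hx => ?_
    exact (hηd (lt_of_lt_of_le (mem_ball.1 hx) (hr ▸ min_le_left _ _))).le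
  · intro z hz
    rw [← norm_le_zero_iff, hder, ← dist_eq_norm, dist_comm]
    refine φ.dist_normed_convolution_le hDcont.aestronglyMeasurable fun x hx => ?_
    have hz' : R + 1 < ‖z‖ := by simpa using hz
    have hx' : dist x z < 1 := lt_of_lt_of_le (mem_ball.1 hx) (hr ▸ min_le_right _ _)
    have h3 : ‖z‖ ≤ ‖x‖ + dist x z := by
      rw [dist_comm, dist_eq_norm]
      have := norm_sub_norm_le z x
      linarith
    rw [hzero x (by linarith), hzero z (by linarith)]
    simp

lemma mollify' (w : ℂ → ℝ) (hw : ContDiff ℝ 1 w) (hc : HasCompactSupport w) (ε : ℝ) (hε : 0 < ε) :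
    ∃ v : ℂ → ℝ, ContDiff ℝ (⊤ : ℕ∞) v ∧ HasCompactSupport v ∧
      (∫⁻ z, ENNReal.ofReal (‖fderiv ℝ w z - fderiv ℝ v z‖ ^ 2)) < ENNReal.ofReal ε := by
  obtain ⟨R, h⟩ := mollify w hw hc
  set V : ℝ := (volume (closedBall (0:ℂ) R)).toReal with hV
  have hV0 : 0 ≤ V := ENNReal.toReal_nonneg
  obtain ⟨v, hv1, hv2, hv3, hv4⟩ := h (Real.sqrt (ε / (V + 1) / 2)) (by positivity)
  refine ⟨v, hv1, hv2, ?_⟩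
  calc (∫⁻ z, ENNReal.ofReal (‖fderiv ℝ w z - fderiv ℝ v z‖ ^ 2))
      ≤ ∫⁻ z, (closedBall (0:ℂ) R).indicator (fun _ => ENNReal.ofReal (ε / (V + 1) / 2)) z := by
        refine lintegral_mono fun z => ?_
        by_cases hz : z ∈ closedBall (0:ℂ) R
        · rw [indicator_of_mem hz]
          refine ENNReal.ofReal_le_ofReal ?_
          have := hv3 z
          rw [Real.le_sqrt (norm_nonneg _) (by positivity)] at this
          exact this
        · simp only [hv4 z hz, indicator_of_notMem hz]
          simp
    _ = ENNReal.ofReal (ε / (V + 1) / 2) * volume (closedBall (0:ℂ) R) :=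
        lintegral_indicator_const measurableSet_closedBall _
    _ = ENNReal.ofReal (ε / (V + 1) / 2 * V) := by
        rw [ENNReal.ofReal_mul (by positivity), hV, ENNReal.ofReal_toReal]
        exact measure_closedBall_lt_top.ne
    _ < ENNReal.ofReal ε := by
        rw [ENNReal.ofReal_lt_ofReal_iff hε]
        rw [div_div, div_mul_eq_mul_div, div_lt_iff₀ (by positivity)]
        nlinarith

lemma sq_add_le {E : Type*} [SeminormedAddCommGroup E] (a b : E) :
    ‖a + b‖ ^ 2 ≤ 2 * ‖a‖ ^ 2 + 2 * ‖b‖ ^ 2 := by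
  have := norm_add_le a b
  nlinarith [norm_nonneg (a + b), norm_nonneg a, norm_nonneg b, sq_nonneg (‖a‖ - ‖b‖)]

/-- Truncation: `C¹` compactly supported approximation. -/
lemma truncate (u : ℂ → ℝ) (hu : ContDiff ℝ 1 u)
    (hE : (∫⁻ z, ENNReal.ofReal (‖fderiv ℝ u z‖ ^ 2)) < ⊤) (ε : ℝ) (hε : 0 < ε) :
    ∃ v : ℂ → ℝ, ContDiff ℝ 1 v ∧ HasCompactSupport v ∧
      (∫⁻ z, ENNReal.ofReal (‖fderiv ℝ u z - fderiv ℝ v z‖ ^ 2)) < ENNReal.ofReal ε := by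
  let ψ : ContDiffBump (0:ℝ) := ⟨1, 2, one_pos, one_lt_two⟩
  have hψ : ContDiff ℝ 1 ψ := ψ.contDiff
  have hψ' : Continuous (deriv ψ) := hψ.continuous_deriv le_rfl
  obtain ⟨C, hC⟩ := (ψ.hasCompactSupport.deriv).exists_bound_of_continuous hψ'
  have hC0 : 0 ≤ C := (norm_nonneg _).trans (hC 0)
  let N : ℕ → ℝ := fun n => (n:ℝ) + 1
  have hN : ∀ n, 0 < N n := fun n => by positivity
  let v : ℕ → ℂ → ℝ := fun n z => ψ (gg z / N n) * (N n * Real.sin (u z / N n))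
  have hv : ∀ n, ContDiff ℝ 1 (v n) := fun n =>
    (hψ.comp (contDiff_gg.div_const _)).mul
      (contDiff_const.mul (Real.contDiff_sin.comp (hu.div_const _)))
  have hvc : ∀ n, HasCompactSupport (v n) := by
    intro n
    refine HasCompactSupport.intro
      (isCompact_closedBall (0:ℂ) (Real.exp (Real.exp (2 * N n)))) fun z hz => ?_
    have h0 : ψ (gg z / N n) = 0 := by
      apply ψ.zero_of_le_dist
      have h1 : 2 * N n < gg z := by
        by_contra hcon
        exact hz (mem_closedBall_zero_iff.2 (norm_le_of_gg_le (not_lt.1 hcon)))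
      rw [dist_zero_right, Real.norm_eq_abs]
      refine le_trans ?_ (le_abs_self _)
      rw [le_div_iff₀ (hN n)]
      exact h1.le
    simp [v, h0]
  have hder : ∀ n z, fderiv ℝ u z - fderiv ℝ (v n) z =
      (1 - ψ (gg z / N n) * Real.cos (u z / N n)) • fderiv ℝ u z +
      (-(Real.sin (u z / N n) * deriv ψ (gg z / N n))) • fderiv ℝ gg z := by
    intro n z
    have hNn := (hN n).ne'
    have du : HasFDerivAt u (fderiv ℝ u z) z :=
      (hu.differentiable one_ne_zero z).hasFDerivAt
    have dg : HasFDerivAt gg (fderiv ℝ gg z) z :=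
      (contDiff_gg.differentiable one_ne_zero z).hasFDerivAt
    have dψ : HasDerivAt ψ (deriv ψ (gg z * (N n)⁻¹)) (gg z * (N n)⁻¹) :=
      (hψ.differentiable one_ne_zero _).hasDerivAt
    have h1 := dψ.comp_hasFDerivAt z (dg.mul_const (N n)⁻¹)
    have h2 := ((du.mul_const (N n)⁻¹).sin).const_mul (N n)
    have h3 : HasFDerivAt (v n) _ z := h1.mul h2
    rw [h3.fderiv]
    ext y
    simp [div_eq_mul_inv]
    field_simp
    ring
  have hbound : ∀ n z, ‖fderiv ℝ u z - fderiv ℝ (v n) z‖ ^ 2 ≤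
      8 * ‖fderiv ℝ u z‖ ^ 2 +
      2 * C ^ 2 * (4 / ((1 + ‖z‖ ^ 2) * (1 + Real.log (1 + ‖z‖ ^ 2)) ^ 2)) := by
    intro n z
    rw [hder]
    refine (sq_add_le _ _).trans ?_
    rw [norm_smul, norm_smul, mul_pow, mul_pow]
    have hg := norm_fderiv_gg z
    have hp0 := ψ.nonneg (x := gg z / N n)
    have hp1 := ψ.le_one (x := gg z / N n)
    have hc := Real.abs_cos_le_one (u z / N n)
    have hs := Real.abs_sin_le_one (u z / N n)
    have hpc : |ψ (gg z / N n) * Real.cos (u z / N n)| ≤ 1 := by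
      rw [abs_mul, abs_of_nonneg hp0]
      exact mul_le_one₀ hp1 (abs_nonneg _) hc
    have a1 : ‖1 - ψ (gg z / N n) * Real.cos (u z / N n)‖ ^ 2 ≤ 4 := by
      rw [Real.norm_eq_abs, sq_abs]
      have := abs_le.1 hpc
      nlinarith
    have a2 : ‖-(Real.sin (u z / N n) * deriv ψ (gg z / N n))‖ ^ 2 ≤ C ^ 2 := by
      rw [norm_neg, norm_mul]
      have : ‖Real.sin (u z / N n)‖ * ‖deriv ψ (gg z / N n)‖ ≤ 1 * C :=
        mul_le_mul hs (hC _) (norm_nonneg _) zero_le_one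
      rw [one_mul] at this
      exact pow_le_pow_left₀ (by positivity) this 2
    have b1 := mul_le_mul_of_nonneg_right a1 (sq_nonneg ‖fderiv ℝ u z‖)
    have b2 := mul_le_mul a2 hg (by positivity) (by positivity)
    linarith
  have hNlim : Tendsto N atTop atTop :=
    tendsto_atTop_add_const_right _ _ tendsto_natCast_atTop_atTop
  have hlim : ∀ z, Tendsto (fun n => ‖fderiv ℝ u z - fderiv ℝ (v n) z‖ ^ 2) atTop (𝓝 0) := by
    intro z
    simp_rw [hder]
    have l1 : Tendsto (fun n => gg z / N n) atTop (𝓝 0) := hNlim.const_div_atTop _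
    have l2 : Tendsto (fun n => u z / N n) atTop (𝓝 0) := hNlim.const_div_atTop _
    have c1 := (ψ.continuous.tendsto 0).comp l1
    have c2 := (Real.continuous_cos.tendsto 0).comp l2
    have c3 := (Real.continuous_sin.tendsto 0).comp l2
    have c4 := (hψ'.tendsto 0).comp l1
    have hψ0 : ψ 0 = 1 := ψ.one_of_mem_closedBall (by simp [ψ])
    have := (((((c1.mul c2).const_sub 1).smul_const (fderiv ℝ u z)).add
      (((c3.mul c4).neg).smul_const (fderiv ℝ gg z))).norm.pow 2)
    simpa [hψ0] using this
  have hT : Tendsto (fun n => ∫⁻ z, ENNReal.ofReal (‖fderiv ℝ u z - fderiv ℝ (v n) z‖ ^ 2))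
      atTop (𝓝 (∫⁻ _ : ℂ, 0)) := by
    refine tendsto_lintegral_of_dominated_convergence
      (fun z => ENNReal.ofReal (8 * ‖fderiv ℝ u z‖ ^ 2 +
      2 * C ^ 2 * (4 / ((1 + ‖z‖ ^ 2) * (1 + Real.log (1 + ‖z‖ ^ 2)) ^ 2)))) ?_ ?_ ?_ ?_
    · intro n
      have h1 := hu.continuous_fderiv one_ne_zero
      have h2 := (hv n).continuous_fderiv one_ne_zero
      exact (ENNReal.continuous_ofReal.comp ((h1.sub h2).norm.pow 2)).measurable
    · intro n
      exact ae_of_all _ fun z => ENNReal.ofReal_le_ofReal (hbound n z)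
    · have i1 : Integrable (fun z => ‖fderiv ℝ u z‖ ^ 2) := by
        refine ⟨((hu.continuous_fderiv one_ne_zero).norm.pow 2).aestronglyMeasurable, ?_⟩
        rw [hasFiniteIntegral_iff_ofReal (ae_of_all _ fun z => by positivity)]
        exact hE
      exact ((i1.const_mul 8).add (integrable_majorant.const_mul (2 * C ^ 2))).lintegral_lt_top.ne
    · refine ae_of_all _ fun z => ?_
      have := (ENNReal.continuous_ofReal.tendsto 0).comp (hlim z)
      rw [ENNReal.ofReal_zero] at this
      exact this
  rw [lintegral_zero] at hT
  obtain ⟨n, hn⟩ := (hT.eventually_lt_const (ENNReal.ofReal_pos.2 hε)).exists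
  exact ⟨v n, hv n, hvc n, hn⟩

end DirichletDensity

/-- **Density of test functions in the homogeneous Dirichlet space.**  If `u : ℂ → ℝ` is
`C¹` with `∫_ℂ ‖∇u‖² dA < ∞`, then for every `ε > 0` there is a smooth compactly
supported `v : ℂ → ℝ` with `∫_ℂ ‖∇u − ∇v‖² dA < ε`. -/
theorem smooth_compactly_supported_dense_in_dirichlet_space
    (u : ℂ → ℝ) (hu : ContDiff ℝ 1 u)
    (hE : (∫⁻ z, ENNReal.ofReal (‖fderiv ℝ u z‖ ^ 2)) < ⊤) :
    ∀ ε > (0:ℝ), ∃ v : ℂ → ℝ, ContDiff ℝ (⊤ : ℕ∞) v ∧ HasCompactSupport v ∧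
      (∫⁻ z, ENNReal.ofReal (‖fderiv ℝ u z - fderiv ℝ v z‖ ^ 2))
        < ENNReal.ofReal ε := by
  intro ε hε
  obtain ⟨w, hw, hwc, hw3⟩ := DirichletDensity.truncate u hu hE (ε / 4) (by positivity)
  obtain ⟨v, hv, hvc, hv3⟩ := DirichletDensity.mollify' w hw hwc (ε / 4) (by positivity)
  refine ⟨v, hv, hvc, ?_⟩
  have hm : Measurable fun z => ENNReal.ofReal (‖fderiv ℝ u z - fderiv ℝ w z‖ ^ 2) :=
    (ENNReal.continuous_ofReal.comp (((hu.continuous_fderiv one_ne_zero).sub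
      (hw.continuous_fderiv one_ne_zero)).norm.pow 2)).measurable
  calc (∫⁻ z, ENNReal.ofReal (‖fderiv ℝ u z - fderiv ℝ v z‖ ^ 2))
      ≤ ∫⁻ z, (2 * ENNReal.ofReal (‖fderiv ℝ u z - fderiv ℝ w z‖ ^ 2) +
          2 * ENNReal.ofReal (‖fderiv ℝ w z - fderiv ℝ v z‖ ^ 2)) := by
        refine lintegral_mono fun z => ?_
        have := DirichletDensity.sq_add_le (fderiv ℝ u z - fderiv ℝ w z)
          (fderiv ℝ w z - fderiv ℝ v z)
        rw [sub_add_sub_cancel] at this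
        refine (ENNReal.ofReal_le_ofReal this).trans (le_of_eq ?_)
        rw [ENNReal.ofReal_add (by positivity) (by positivity),
          ENNReal.ofReal_mul zero_le_two, ENNReal.ofReal_mul zero_le_two]
        simp
    _ = 2 * (∫⁻ z, ENNReal.ofReal (‖fderiv ℝ u z - fderiv ℝ w z‖ ^ 2)) +
        2 * (∫⁻ z, ENNReal.ofReal (‖fderiv ℝ w z - fderiv ℝ v z‖ ^ 2)) := by
        rw [lintegral_add_left (hm.const_mul 2), lintegral_const_mul' _ _ (by simp),
          lintegral_const_mul' _ _ (by simp)]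
    _ < 2 * ENNReal.ofReal (ε / 4) + 2 * ENNReal.ofReal (ε / 4) := by
        refine ENNReal.add_lt_add ?_ ?_
        · exact ENNReal.mul_lt_mul_right (by simp) (by simp) hw3
        · exact ENNReal.mul_lt_mul_right (by simp) (by simp) hv3
    _ = ENNReal.ofReal ε := by
        rw [show (2:ℝ≥0∞) = ENNReal.ofReal 2 by simp, ← ENNReal.ofReal_mul zero_le_two,
          ← ENNReal.ofReal_add (by positivity) (by positivity)]
        congr 1
        ring
end
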